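/- arXiv:2406.16323 — 5 statements merged into one kernel-verified Lean document; each statement's English description precedes it below -/
import Mathlib

section
/- Let n be a positive integer, C ≥ 0, K a natural number, and let f : ℝⁿ → ℝ be differentiable with continuous gradient ∇f. For each t ∈ ℕ let d⁽ᵗ⁾ : (ℝⁿ)⁶ → ℝⁿ be differentiable with the operator norm of its total derivative bounded by C at every point, and let m : (ℝⁿ)^(K+1) → ℝⁿ be differentiable with the operator norm of its total derivative bounded by C at every point. Let (x⁽ᵗ⁾), (g⁽ᵗ⁾) be sequences in ℝⁿ and define y⁽ᵗ⁾ = m(x⁽ᵗ⁾, x⁽ᵗ⁻¹⁾, …, x⁽ᵗ⁻ᴷ⁾) for t ≥ K, and suppose x⁽ᵗ⁺¹⁾ = x⁽ᵗ⁾ − d⁽ᵗ⁾(x⁽ᵗ⁾, ∇f(x⁽ᵗ⁾), x⁽ᵗ⁺¹⁾, g⁽ᵗ⁺¹⁾, y⁽ᵗ⁾, ∇f(y⁽ᵗ⁾)) for all t ≥ K. If there is a point x* ∈ ℝⁿ such that x⁽ᵗ⁾ → x*, y⁽ᵗ⁾ → x*, and g⁽ᵗ⁺¹⁾ → −∇f(x*)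 as t → ∞, then (i) d⁽ᵗ⁾(x*, ∇f(x*), x*, −∇f(x*), x*, ∇f(x*)) → 0 as t → ∞, and (ii) m(x*, x*, …, x*) = x*. -/
open Filter Topology

/-- A sequence of maps with uniformly bounded derivatives is asymptotically insensitive to
replacing the limit of a convergent sequence by its terms. -/
theorem tendsto_sub_of_norm_fderiv_le {ι E F : Type*} [NormedAddCommGroup E] [NormedSpace ℝ E]
    [NormedAddCommGroup F] [NormedSpace ℝ F] {l : Filter ι} {C : ℝ} {φ : ι → E → F}
    (hφ : ∀ t, Differentiable ℝ (φ t)) (hC : ∀ t z, ‖fderiv ℝ (φ t) z‖ ≤ C)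
    {u : ι → E} {a : E} (hu : Tendsto u l (𝓝 a)) :
    Tendsto (fun t => φ t a - φ t (u t)) l (𝓝 0) := by
  have hbound : Tendsto (fun t => C * ‖a - u t‖) l (𝓝 0) := by
    simpa using ((tendsto_const_nhds (x := a)).sub hu).norm.const_mul C
  refine squeeze_zero_norm (fun t => ?_) hbound
  exact convex_univ.norm_image_sub_le_of_norm_fderiv_le (fun z _ => hφ t z)
    (fun z _ => hC t z) (Set.mem_univ _) (Set.mem_univ _)

/-- **Theorem 1 of the paper** (asymptotic fixed-point conditions (22) and (23) for the
learned update rule, with the implicit global-convergence assumption on the generated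
sequences made explicit). `f : ℝⁿ → ℝ` is differentiable with continuous gradient; each
update rule `d⁽ᵗ⁾ : (ℝⁿ)⁶ → ℝⁿ` and the history operator `m : (ℝⁿ)^(K+1) → ℝⁿ` are
differentiable with the operator norm of their total derivatives bounded by `C`
everywhere (all products carrying the ℓ² product norm). If the iterates
`x⁽ᵗ⁺¹⁾ = x⁽ᵗ⁾ − d⁽ᵗ⁾(x⁽ᵗ⁾, ∇f(x⁽ᵗ⁾), x⁽ᵗ⁺¹⁾, g⁽ᵗ⁺¹⁾, y⁽ᵗ⁾, ∇f(y⁽ᵗ⁾))` with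
`y⁽ᵗ⁾ = m(x⁽ᵗ⁾, …, x⁽ᵗ⁻ᴷ⁾)` satisfy `x⁽ᵗ⁾ → x*`, `y⁽ᵗ⁾ → x*`, `g⁽ᵗ⁺¹⁾ → −∇f(x*)`,
then (i) `d⁽ᵗ⁾(x*, ∇f(x*), x*, −∇f(x*), x*, ∇f(x*)) → 0` and
(ii) `m(x*, …, x*) = x*`. -/
theorem stmt_0 (n : ℕ) (hn : 0 < n) (C : ℝ) (hC : 0 ≤ C) (K : ℕ)
    (f : EuclideanSpace ℝ (Fin n) → ℝ) (hf : Differentiable ℝ f)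
    (hgrad : Continuous (gradient f))
    (d : ℕ → (PiLp 2 fun _ : Fin 6 => EuclideanSpace ℝ (Fin n)) → EuclideanSpace ℝ (Fin n))
    (hd : ∀ t, Differentiable ℝ (d t))
    (hdC : ∀ t z, ‖fderiv ℝ (d t) z‖ ≤ C)
    (m : (PiLp 2 fun _ : Fin (K + 1) => EuclideanSpace ℝ (Fin n)) → EuclideanSpace ℝ (Fin n))
    (hm : Differentiable ℝ m)
    (hmC : ∀ z, ‖fderiv ℝ m z‖ ≤ C)
    (x g y : ℕ → EuclideanSpace ℝ (Fin n))
    (hy : ∀ t, K ≤ t →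
      y t = m ((WithLp.equiv 2 _).symm fun i : Fin (K + 1) => x (t - (i : ℕ))))
    (hx : ∀ t, K ≤ t → x (t + 1) = x t -
      d t ((WithLp.equiv 2 _).symm
        ![x t, gradient f (x t), x (t + 1), g (t + 1), y t, gradient f (y t)]))
    (xstar : EuclideanSpace ℝ (Fin n))
    (hxlim : Tendsto x atTop (nhds xstar))
    (hylim : Tendsto y atTop (nhds xstar))
    (hglim : Tendsto (fun t => g (t + 1)) atTop (nhds (-(gradient f xstar)))) :
    Tendsto (fun t => d t ((WithLp.equiv 2 _).symm
        ![xstar, gradient f xstar, xstar, -(gradient f xstar), xstar, gradient f xstar]))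
      atTop (nhds 0) ∧
    m ((WithLp.equiv 2 _).symm fun _ : Fin (K + 1) => xstar) = xstar := by
  have hgx := (hgrad.tendsto xstar).comp hxlim
  have hgy := (hgrad.tendsto xstar).comp hylim
  have hx1 : Tendsto (fun t => x (t + 1)) atTop (𝓝 xstar) := hxlim.comp (tendsto_add_atTop_nat 1)
  constructor
  · have harg : Tendsto (fun t => (WithLp.equiv 2 (Fin 6 → EuclideanSpace ℝ (Fin n))).symm
        ![x t, gradient f (x t), x (t + 1), g (t + 1), y t, gradient f (y t)]) atTop
        (𝓝 ((WithLp.equiv 2 (Fin 6 → EuclideanSpace ℝ (Fin n))).symm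
          ![xstar, gradient f xstar, xstar, -(gradient f xstar), xstar, gradient f xstar])) := by
      refine ((PiLp.continuous_toLp 2 _).tendsto _).comp (tendsto_pi_nhds.2 fun i => ?_)
      fin_cases i
      exacts [hxlim, hgx, hx1, hglim, hylim, hgy]
    have hstep : Tendsto (fun t => d t ((WithLp.equiv 2 _).symm
        ![x t, gradient f (x t), x (t + 1), g (t + 1), y t, gradient f (y t)]))
        atTop (𝓝 0) := by
      have hdiff : Tendsto (fun t => x t - x (t + 1)) atTop (𝓝 0) := by
        simpa using hxlim.sub hx1
      refine hdiff.congr' ?_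
      filter_upwards [eventually_ge_atTop K] with t ht
      exact sub_eq_iff_eq_add'.2 (eq_sub_iff_add_eq.1 (hx t ht)).symm
    simpa using (tendsto_sub_of_norm_fderiv_le hd hdC harg).add hstep
  · have harg : Tendsto (fun t => (WithLp.equiv 2 (Fin (K + 1) → EuclideanSpace ℝ (Fin n))).symm
        fun i : Fin (K + 1) => x (t - (i : ℕ))) atTop
        (𝓝 ((WithLp.equiv 2 (Fin (K + 1) → EuclideanSpace ℝ (Fin n))).symm
          fun _ : Fin (K + 1) => xstar)) :=
      ((PiLp.continuous_toLp 2 _).tendsto _).comp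
        (tendsto_pi_nhds.2 fun i => hxlim.comp (tendsto_sub_atTop_nat i))
    have hmy : Tendsto (fun t => m ((WithLp.equiv 2 _).symm
        fun i : Fin (K + 1) => x (t - (i : ℕ)))) atTop (𝓝 xstar) := by
      refine hylim.congr' ?_
      filter_upwards [eventually_ge_atTop K] with t ht
      exact hy t ht
    have hsum := (tendsto_sub_of_norm_fderiv_le (fun _ : ℕ => hm) (fun _ => hmC) harg).add hmy
    simp only [sub_add_cancel, zero_add] at hsum
    exact tendsto_nhds_unique tendsto_const_nhds hsum
end

section
/- Let n, m be positive integers and C ≥ 0. Let o : (ℝⁿ)ᵐ → ℝⁿ be a differentiable map such that the operator norm of its total derivative is at most C at every point of (ℝⁿ)ᵐ. Then for any points x⁽¹⁾, …, x⁽ᵐ⁾, y⁽¹⁾, …, y⁽ᵐ⁾ ∈ ℝⁿ there exist continuous linear maps J₁, …, Jₘ : ℝⁿ → ℝⁿ such that o(x⁽¹⁾, x⁽²⁾, …, x⁽ᵐ⁾) − o(y⁽¹⁾, y⁽²⁾, …, y⁽ᵐ⁾) = Σ_{j=1}^{m} Jⱼ(x⁽ʲ⁾ − y⁽ʲ⁾),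 and the operator norm of each Jⱼ is at most √n · C. -/
open Finset

/-- A vector `v` with `‖v‖ ≤ C * ‖d‖` is the image of `d` under a row of rank-one operators, each of
operator norm at most `C`. -/
theorem PiLp.exists_sum_clm_apply_eq_of_norm_le {ι F : Type*} {E : ι → Type*} [Fintype ι]
    [∀ i, NormedAddCommGroup (E i)] [∀ i, InnerProductSpace ℝ (E i)]
    [NormedAddCommGroup F] [NormedSpace ℝ F] {C : ℝ} (hC : 0 ≤ C) (d : PiLp 2 E) {v : F}
    (hv : ‖v‖ ≤ C * ‖d‖) :
    ∃ J : ∀ i, E i →L[ℝ] F, v = ∑ i, J i (d i) ∧ ∀ i, ‖J i‖ ≤ C := by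
  rcases eq_or_ne d 0 with rfl | hd
  · refine ⟨0, ?_, fun _ => by simpa using hC⟩
    simpa using hv
  have hd' : 0 < ‖d‖ := norm_pos_iff.mpr hd
  refine ⟨fun i => (innerSL ℝ (d i)).smulRight ((‖d‖ ^ 2)⁻¹ • v), ?_, fun i => ?_⟩
  · simp only [ContinuousLinearMap.smulRight_apply, innerSL_apply_apply,
      real_inner_self_eq_norm_sq]
    rw [← Finset.sum_smul, ← PiLp.norm_sq_eq_of_L2, smul_inv_smul₀ (by positivity)]
  · rw [ContinuousLinearMap.norm_smulRight_apply, innerSL_apply_norm, norm_smul, norm_inv,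
      norm_pow, norm_norm]
    calc ‖d i‖ * ((‖d‖ ^ 2)⁻¹ * ‖v‖) ≤ ‖d‖ * ((‖d‖ ^ 2)⁻¹ * (C * ‖d‖)) := by
          gcongr
          exact PiLp.norm_apply_le d i
      _ = C := by field_simp

/-- **Lemma 1 of the paper** (mean-value representation for vector-valued operators with
uniformly bounded Jacobian): for a differentiable `o : (ℝⁿ)ᵐ → ℝⁿ` (with the product ℓ²
norm on `(ℝⁿ)ᵐ`) whose total derivative has operator norm at most `C` everywhere, the
difference of values of `o` at two `m`-tuples of points can be written as a sum of
linear maps, each of operator norm at most `√n · C`, applied to the coordinate-wise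
differences. -/
theorem stmt_1 (n m : ℕ) (hn : 0 < n) (hm : 0 < m) (C : ℝ) (hC : 0 ≤ C)
    (o : PiLp 2 (fun _ : Fin m => EuclideanSpace ℝ (Fin n)) → EuclideanSpace ℝ (Fin n))
    (ho : Differentiable ℝ o)
    (hoC : ∀ z, ‖fderiv ℝ o z‖ ≤ C)
    (x y : PiLp 2 (fun _ : Fin m => EuclideanSpace ℝ (Fin n))) :
    ∃ J : Fin m → (EuclideanSpace ℝ (Fin n) →L[ℝ] EuclideanSpace ℝ (Fin n)),
      o x - o y = ∑ j : Fin m, J j (x j - y j) ∧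
      ∀ j : Fin m, ‖J j‖ ≤ Real.sqrt n * C := by
  have hv : ‖o x - o y‖ ≤ C * ‖x - y‖ :=
    convex_univ.norm_image_sub_le_of_norm_fderiv_le (fun z _ => ho z) (fun z _ => hoC z)
      (Set.mem_univ y) (Set.mem_univ x)
  obtain ⟨J, hJ, hJC⟩ := PiLp.exists_sum_clm_apply_eq_of_norm_le hC (x - y) hv
  have hn' : 1 ≤ Real.sqrt n := Real.one_le_sqrt.mpr (by exact_mod_cast hn)
  exact ⟨J, hJ, fun j => (hJC j).trans (le_mul_of_one_le_left hC hn')⟩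
end

section
/- Let n be a positive integer, C ≥ 0, let f : ℝⁿ → ℝ be differentiable with gradient ∇f, and let d : (ℝⁿ)⁶ → ℝⁿ be differentiable with the operator norm of its total derivative bounded by C at every point. Fix x* ∈ ℝⁿ and set d̂ = d(x*, ∇f(x*), x*, −∇f(x*), x*, ∇f(x*)). Then for every x, x⁺, y, g ∈ ℝⁿ and every continuous linear map B : ℝⁿ → ℝⁿ, there exist continuous linear maps P₁, P₂ : ℝⁿ → ℝⁿ with ‖P₁‖ ≤ √n·C and ‖P₂‖ ≤ √n·C and a vector b₁ ∈ ℝⁿ such that x − d(x, ∇f(x), x⁺, g, y, ∇f(y)) = x − (P₁ − P₂)(∇f(x)) − P₂(∇f(y)) − P₁(g) + B(y − x) − b₁, and moreover ‖b₁‖ ≤ √n·C·(‖x − x*‖ + ‖x⁺ − x*‖ + ‖y − x*‖) + ‖d̂‖ + ‖B‖·‖y − x‖ + 3√n·C·‖∇f(x) − ∇f(x*)‖. -/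
/-- A vector `w` with `‖w‖ ≤ C * ‖v‖` is the image of `v` under a continuous linear map of norm at
most `C`. -/
theorem exists_clm_apply_eq_of_norm_le {E F : Type*} [NormedAddCommGroup E]
    [InnerProductSpace ℝ E] [NormedAddCommGroup F] [NormedSpace ℝ F] {C : ℝ} (hC : 0 ≤ C)
    {v : E} {w : F} (h : ‖w‖ ≤ C * ‖v‖) : ∃ J : E →L[ℝ] F, ‖J‖ ≤ C ∧ J v = w := by
  rcases eq_or_ne v 0 with rfl | hv
  · exact ⟨0, by simpa using hC, by simpa [eq_comm] using h⟩
  · have hv' : 0 < ‖v‖ := norm_pos_iff.2 hv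
    refine ⟨(innerSL ℝ v).smulRight ((‖v‖ ^ 2)⁻¹ • w), ?_, ?_⟩
    · rw [ContinuousLinearMap.norm_smulRight_apply, innerSL_apply_norm, norm_smul, norm_inv,
        norm_pow, norm_norm]
      calc ‖v‖ * ((‖v‖ ^ 2)⁻¹ * ‖w‖) ≤ ‖v‖ * ((‖v‖ ^ 2)⁻¹ * (C * ‖v‖)) := by gcongr
        _ = C := by field_simp
    · simp [smul_smul, hv'.ne']

/-- Blockwise version of `exists_clm_apply_eq_of_norm_le` on an `ℓ²` product. -/
theorem exists_clm_sum_apply_eq_of_norm_le {ι E F : Type*} [Fintype ι] [NormedAddCommGroup E]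
    [InnerProductSpace ℝ E] [NormedAddCommGroup F] [NormedSpace ℝ F] {C : ℝ} (hC : 0 ≤ C)
    {v : PiLp 2 fun _ : ι => E} {w : F} (h : ‖w‖ ≤ C * ‖v‖) :
    ∃ J : ι → E →L[ℝ] F, (∀ i, ‖J i‖ ≤ C) ∧ ∑ i, J i (v i) = w := by
  classical
  obtain ⟨J, hJ, hJv⟩ := exists_clm_apply_eq_of_norm_le hC h
  refine ⟨fun i => J ∘L (PiLp.continuousLinearEquiv 2 ℝ fun _ : ι => E).symm.toContinuousLinearMap
    ∘L ContinuousLinearMap.single ℝ (fun _ : ι => E) i, fun i => ?_, ?_⟩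
  · refine ContinuousLinearMap.opNorm_le_bound _ hC fun u => ?_
    have := J.le_of_opNorm_le hJ (PiLp.single 2 i u)
    rwa [PiLp.norm_single] at this
  · rw [← hJv]
    simp only [ContinuousLinearMap.comp_apply]
    rw [← map_sum, ← map_sum]
    congr 1
    ext1 j
    simp [Finset.sum_apply, Pi.single_apply]


/-- **Central decomposition in the proof of Theorem 1 (Appendix A)**: any update
direction built from a differentiable map `d : (ℝⁿ)⁶ → ℝⁿ` (product ℓ² norm) with the
operator norm of its total derivative bounded by `C` everywhere can be rewritten in the
math-structured form (17) of the paper: with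
`d̂ = d(x*, ∇f(x*), x*, −∇f(x*), x*, ∇f(x*))`, for every `x, x⁺, y, g` and every
continuous linear `B` there are continuous linear `P₁, P₂` with `‖P₁‖, ‖P₂‖ ≤ √n·C`
and a vector `b₁` such that
`x − d(x, ∇f(x), x⁺, g, y, ∇f(y)) = x − (P₁−P₂)(∇f(x)) − P₂(∇f(y)) − P₁(g) + B(y−x) − b₁`,
with `‖b₁‖ ≤ √n·C·(‖x−x*‖+‖x⁺−x*‖+‖y−x*‖) + ‖d̂‖ + ‖B‖·‖y−x‖ + 3√n·C·‖∇f(x)−∇f(x*)‖`. -/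
theorem stmt_3 (n : ℕ) (hn : 0 < n) (C : ℝ) (hC : 0 ≤ C)
    (f : EuclideanSpace ℝ (Fin n) → ℝ) (hf : Differentiable ℝ f)
    (d : (PiLp 2 fun _ : Fin 6 => EuclideanSpace ℝ (Fin n)) → EuclideanSpace ℝ (Fin n))
    (hd : Differentiable ℝ d)
    (hdC : ∀ z, ‖fderiv ℝ d z‖ ≤ C)
    (xstar : EuclideanSpace ℝ (Fin n)) :
    ∀ (x xp y g : EuclideanSpace ℝ (Fin n))
      (B : EuclideanSpace ℝ (Fin n) →L[ℝ] EuclideanSpace ℝ (Fin n)),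
      ∃ (P₁ P₂ : EuclideanSpace ℝ (Fin n) →L[ℝ] EuclideanSpace ℝ (Fin n))
        (b₁ : EuclideanSpace ℝ (Fin n)),
        ‖P₁‖ ≤ Real.sqrt n * C ∧ ‖P₂‖ ≤ Real.sqrt n * C ∧
        x - d ((WithLp.equiv 2 _).symm
            ![x, gradient f x, xp, g, y, gradient f y]) =
          x - (P₁ - P₂) (gradient f x) - P₂ (gradient f y) - P₁ g + B (y - x) - b₁ ∧
        ‖b₁‖ ≤ Real.sqrt n * C * (‖x - xstar‖ + ‖xp - xstar‖ + ‖y - xstar‖) +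
          ‖d ((WithLp.equiv 2 _).symm
            ![xstar, gradient f xstar, xstar, -(gradient f xstar), xstar,
              gradient f xstar])‖ +
          ‖B‖ * ‖y - x‖ +
          3 * Real.sqrt n * C * ‖gradient f x - gradient f xstar‖ := by
  intro x xp y g B
  set a := gradient f x
  set c := gradient f xstar
  set h := gradient f y
  set z := (WithLp.equiv 2 (Fin 6 → EuclideanSpace ℝ (Fin n))).symm ![x, a, xp, g, y, h] with hz
  set zs := (WithLp.equiv 2 (Fin 6 → EuclideanSpace ℝ (Fin n))).symm
    ![xstar, c, xstar, -c, xstar, c] with hzs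
  have hlip : ‖d z - d zs‖ ≤ C * ‖z - zs‖ :=
    convex_univ.norm_image_sub_le_of_norm_fderiv_le (fun w _ => hd w) (fun w _ => hdC w)
      (Set.mem_univ _) (Set.mem_univ _)
  obtain ⟨J, hJ, hsum⟩ := exists_clm_sum_apply_eq_of_norm_le hC hlip
  have hCn : C ≤ Real.sqrt n * C :=
    le_mul_of_one_le_left hC (Real.one_le_sqrt.2 (by exact_mod_cast hn))
  have hJn (i : Fin 6) : ‖J i‖ ≤ Real.sqrt n * C := (hJ i).trans hCn
  have hdz : d z = J 0 (x - xstar) + J 1 (a - c) + J 2 (xp - xstar) + J 3 (g + c)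
      + J 4 (y - xstar) + J 5 (h - c) + d zs := by
    rw [← sub_eq_iff_eq_add, ← hsum]
    simp [Fin.sum_univ_six, hz, hzs]
    abel
  refine ⟨J 3, J 5, J 0 (x - xstar) + J 2 (xp - xstar) + J 4 (y - xstar) + d zs + B (y - x)
    + (J 1 (a - c) - J 3 (a - c) + J 5 (a - c)), hJn 3, hJn 5, ?_, ?_⟩
  · rw [hdz]
    simp only [map_sub, map_add, sub_apply]
    abel
  · have hgrad : ‖J 1 (a - c) - J 3 (a - c) + J 5 (a - c)‖ ≤
        ‖J 1 (a - c)‖ + ‖J 3 (a - c)‖ + ‖J 5 (a - c)‖ :=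
      (norm_add_le _ _).trans (by gcongr; exact norm_sub_le _ _)
    have hJle (i : Fin 6) := (J i).le_of_opNorm_le (hJn i)
    refine (norm_add_le_of_le (norm_add_le_of_le norm_add₄_le (B.le_opNorm _)) hgrad).trans ?_
    linarith [hJle 0 (x - xstar), hJle 1 (a - c), hJle 2 (xp - xstar), hJle 3 (a - c),
      hJle 4 (y - xstar), hJle 5 (a - c)]
end

section
/- Let n be a positive integer, C ≥ 0, let f : ℝⁿ → ℝ be differentiable with continuous gradient ∇f, and fix x* ∈ ℝⁿ. For each t ∈ ℕ let d⁽ᵗ⁾ : (ℝⁿ)⁶ → ℝⁿ be differentiable with the operator norm of its total derivative bounded by C at every point. Let (x⁽ᵗ⁾), (y⁽ᵗ⁾), (g⁽ᵗ⁾) be sequences in ℝⁿ satisfying x⁽ᵗ⁺¹⁾ = x⁽ᵗ⁾ − d⁽ᵗ⁾(x⁽ᵗ⁾, ∇f(x⁽ᵗ⁾), x⁽ᵗ⁺¹⁾, g⁽ᵗ⁺¹⁾, y⁽ᵗ⁾, ∇f(y⁽ᵗ⁾)) for all t, and let (B⁽ᵗ⁾) be a sequence of continuous linear maps ℝⁿ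 → ℝⁿ with sup_t ‖B⁽ᵗ⁾‖ < ∞. Then there exist sequences of continuous linear maps (P₁⁽ᵗ⁾), (P₂⁽ᵗ⁾) on ℝⁿ with ‖P₁⁽ᵗ⁾‖ ≤ √n·C and ‖P₂⁽ᵗ⁾‖ ≤ √n·C for all t, and a sequence of vectors (b₁⁽ᵗ⁾) in ℝⁿ, such that for every t: x⁽ᵗ⁺¹⁾ = x⁽ᵗ⁾ − (P₁⁽ᵗ⁾ − P₂⁽ᵗ⁾)(∇f(x⁽ᵗ⁾)) − P₂⁽ᵗ⁾(∇f(y⁽ᵗ⁾)) − P₁⁽ᵗ⁾(g⁽ᵗ⁺¹⁾) + B⁽ᵗ⁾(y⁽ᵗ⁾ − x⁽ᵗ⁾) − b₁⁽ᵗ⁾; and furthermore, if x⁽ᵗ⁾ → x*, y⁽ᵗ⁾ → x*, and d⁽ᵗ⁾(x*, ∇f(x*), x*, −∇f(x*), x*, ∇f(x*)) → 0 as t → ∞, then b₁⁽ᵗ⁾ → 0. -/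
open Filter Topology

/-- A continuous linear map may be prescribed at one vector without increasing the norm ratio. -/
theorem exists_continuousLinearMap_apply_eq_of_norm_le {E F : Type*}
    [NormedAddCommGroup E] [NormedSpace ℝ E] [NormedAddCommGroup F] [NormedSpace ℝ F]
    {C : ℝ} (hC : 0 ≤ C) {v : E} {w : F} (h : ‖w‖ ≤ C * ‖v‖) :
    ∃ P : E →L[ℝ] F, ‖P‖ ≤ C ∧ P v = w := by
  rcases eq_or_ne v 0 with rfl | hv
  · have hw : w = 0 := by simpa using h
    exact ⟨0, by simpa using hC, by simp [hw]⟩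
  have hv' : 0 < ‖v‖ := norm_pos_iff.mpr hv
  obtain ⟨φ, hφ, hφv⟩ := exists_dual_vector'' ℝ v
  refine ⟨φ.smulRight (‖v‖⁻¹ • w), ?_, ?_⟩
  · rw [ContinuousLinearMap.norm_smulRight_apply, norm_smul, norm_inv, norm_norm]
    have hw : ‖v‖⁻¹ * ‖w‖ ≤ C := by
      rw [inv_mul_le_iff₀ hv']
      linarith
    calc ‖φ‖ * (‖v‖⁻¹ * ‖w‖) ≤ 1 * (‖v‖⁻¹ * ‖w‖) := by gcongr
      _ ≤ C := by simpa using hw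
  · rw [ContinuousLinearMap.smulRight_apply, hφv, smul_smul]
    simp [hv'.ne']

/-- Uniformly bounded operators send null sequences to null sequences. -/
theorem tendsto_clm_apply_zero_of_norm_le {E F : Type*}
    [NormedAddCommGroup E] [NormedSpace ℝ E] [NormedAddCommGroup F] [NormedSpace ℝ F]
    {M : ℝ} {A : ℕ → E →L[ℝ] F} (hA : ∀ t, ‖A t‖ ≤ M) {v : ℕ → E}
    (hv : Tendsto v atTop (𝓝 0)) : Tendsto (fun t => A t (v t)) atTop (𝓝 0) := by
  refine squeeze_zero_norm (fun t => (A t).le_of_opNorm_le (hA t) (v t)) ?_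
  simpa using hv.norm.const_mul M

/-- **Sequence-level content of Theorem 1's proof (Appendix A)**: any sequence of
learned updates `x⁽ᵗ⁺¹⁾ = x⁽ᵗ⁾ − d⁽ᵗ⁾(x⁽ᵗ⁾, ∇f(x⁽ᵗ⁾), x⁽ᵗ⁺¹⁾, g⁽ᵗ⁺¹⁾, y⁽ᵗ⁾, ∇f(y⁽ᵗ⁾))`
generated by maps `d⁽ᵗ⁾ : (ℝⁿ)⁶ → ℝⁿ` (product ℓ² norm) with uniformly bounded
Jacobians, together with any uniformly bounded sequence `B⁽ᵗ⁾` of continuous linear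
maps, is exactly representable in the math-structured update form (17) of the paper
with preconditioners `P₁⁽ᵗ⁾, P₂⁽ᵗ⁾` of operator norm at most `√n·C`; moreover the bias
terms `b₁⁽ᵗ⁾` vanish asymptotically whenever `x⁽ᵗ⁾ → x*`, `y⁽ᵗ⁾ → x*`, and
`d⁽ᵗ⁾(x*, ∇f(x*), x*, −∇f(x*), x*, ∇f(x*)) → 0`. -/
theorem stmt_4 (n : ℕ) (hn : 0 < n) (C : ℝ) (hC : 0 ≤ C)
    (f : EuclideanSpace ℝ (Fin n) → ℝ) (hf : Differentiable ℝ f)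
    (hgrad : Continuous (gradient f))
    (xstar : EuclideanSpace ℝ (Fin n))
    (d : ℕ → (PiLp 2 fun _ : Fin 6 => EuclideanSpace ℝ (Fin n)) → EuclideanSpace ℝ (Fin n))
    (hd : ∀ t, Differentiable ℝ (d t))
    (hdC : ∀ t z, ‖fderiv ℝ (d t) z‖ ≤ C)
    (x y g : ℕ → EuclideanSpace ℝ (Fin n))
    (hx : ∀ t, x (t + 1) = x t -
      d t ((WithLp.equiv 2 _).symm
        ![x t, gradient f (x t), x (t + 1), g (t + 1), y t, gradient f (y t)]))
    (B : ℕ → (EuclideanSpace ℝ (Fin n) →L[ℝ] EuclideanSpace ℝ (Fin n)))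
    (hB : ∃ MB : ℝ, ∀ t, ‖B t‖ ≤ MB) :
    ∃ (P₁ P₂ : ℕ → (EuclideanSpace ℝ (Fin n) →L[ℝ] EuclideanSpace ℝ (Fin n)))
      (b₁ : ℕ → EuclideanSpace ℝ (Fin n)),
      (∀ t, ‖P₁ t‖ ≤ Real.sqrt n * C) ∧
      (∀ t, ‖P₂ t‖ ≤ Real.sqrt n * C) ∧
      (∀ t, x (t + 1) =
        x t - (P₁ t - P₂ t) (gradient f (x t)) - (P₂ t) (gradient f (y t)) -
          (P₁ t) (g (t + 1)) + (B t) (y t - x t) - b₁ t) ∧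
      (Tendsto x atTop (nhds xstar) → Tendsto y atTop (nhds xstar) →
        Tendsto (fun t => d t ((WithLp.equiv 2 _).symm
            ![xstar, gradient f xstar, xstar, -(gradient f xstar), xstar,
              gradient f xstar])) atTop (nhds 0) →
        Tendsto b₁ atTop (nhds 0)) := by
  have hlip : ∀ t z z', ‖d t z - d t z'‖ ≤ C * ‖z - z'‖ := fun t z z' =>
    convex_univ.norm_image_sub_le_of_norm_fderiv_le (fun w _ => hd t w)
      (fun w _ => hdC t w) (Set.mem_univ z') (Set.mem_univ z)
  have hCn : C ≤ Real.sqrt n * C :=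
    le_mul_of_one_le_left hC (Real.one_le_sqrt.mpr (by exact_mod_cast hn))
  set u := gradient f xstar
  -- the limit point, with its fourth block replaced by `w`
  let q : EuclideanSpace ℝ (Fin n) → PiLp 2 fun _ : Fin 6 => EuclideanSpace ℝ (Fin n) :=
    fun w => (WithLp.equiv 2 _).symm ![xstar, u, xstar, w, xstar, u]
  have hq : ∀ w w', ‖q w - q w'‖ = ‖w - w'‖ := by
    intro w w'
    simp [q, PiLp.norm_eq_of_L2, Fin.sum_univ_six]
  have hP : ∀ t, ∃ P : EuclideanSpace ℝ (Fin n) →L[ℝ] EuclideanSpace ℝ (Fin n),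
      ‖P‖ ≤ C ∧ P (g (t + 1) - -u) = d t (q (g (t + 1))) - d t (q (-u)) := fun t =>
    exists_continuousLinearMap_apply_eq_of_norm_le hC
      ((hlip t _ _).trans_eq (by rw [hq]))
  choose P hPC hPg using hP
  let z : ℕ → PiLp 2 fun _ : Fin 6 => EuclideanSpace ℝ (Fin n) := fun t =>
    (WithLp.equiv 2 _).symm
      ![x t, gradient f (x t), x (t + 1), g (t + 1), y t, gradient f (y t)]
  refine ⟨P, fun _ => 0, fun t => d t (z t) - P t (gradient f (x t) + g (t + 1)) +
    B t (y t - x t), fun t => (hPC t).trans hCn, fun t => ?_, fun t => ?_, ?_⟩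
  · simpa using hC.trans hCn
  · rw [hx t]
    simp only [z, map_add, sub_zero, zero_apply]
    abel
  · intro hxs hys hds
    obtain ⟨M, hM⟩ := hB
    have hxg : Tendsto (fun t => gradient f (x t) - u) atTop (𝓝 0) :=
      tendsto_sub_nhds_zero_iff.mpr ((hgrad.tendsto xstar).comp hxs)
    have hyg : Tendsto (fun t => gradient f (y t) - u) atTop (𝓝 0) :=
      tendsto_sub_nhds_zero_iff.mpr ((hgrad.tendsto xstar).comp hys)
    have hx0 : Tendsto (fun t => x t - xstar) atTop (𝓝 0) := tendsto_sub_nhds_zero_iff.mpr hxs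
    have hy0 : Tendsto (fun t => y t - xstar) atTop (𝓝 0) := tendsto_sub_nhds_zero_iff.mpr hys
    have hz : Tendsto (fun t => z t - q (g (t + 1))) atTop (𝓝 0) := by
      have hpi : Tendsto (fun t => WithLp.ofLp (z t - q (g (t + 1)))) atTop (𝓝 0) := by
        rw [tendsto_pi_nhds]
        intro i
        fin_cases i
        · simpa [z, q] using hx0
        · simpa [z, q] using hxg
        · simpa [z, q, Function.comp_def] using hx0.comp (tendsto_add_atTop_nat 1)
        · simp [z, q]
        · simpa [z, q] using hy0
        · simpa [z, q] using hyg
      simpa [Function.comp_def] using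
        ((PiLp.continuous_toLp 2 fun _ : Fin 6 => EuclideanSpace ℝ (Fin n)).tendsto 0).comp hpi
    have hdz : Tendsto (fun t => d t (z t) - d t (q (g (t + 1)))) atTop (𝓝 0) :=
      squeeze_zero_norm (fun t => hlip t _ _) (by simpa using hz.norm.const_mul C)
    have hPx := tendsto_clm_apply_zero_of_norm_le hPC hxg
    have hyx : Tendsto (fun t => y t - x t) atTop (𝓝 0) := by
      simpa using hys.sub hxs
    have hBy := tendsto_clm_apply_zero_of_norm_le hM hyx
    have key := ((hdz.add hds).sub hPx).add hBy
    simp only [add_zero, sub_zero] at key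
    refine key.congr fun t => ?_
    have h := hPg t
    have h' : d t (q (g (t + 1))) = P t (g (t + 1)) + P t u + d t (q (-u)) := by
      rw [← map_add, ← sub_neg_eq_add (g (t + 1)), h, sub_add_cancel]
    rw [h']
    simp only [q, map_add, map_sub]
    abel
end

section
/- Let n be a positive integer, C ≥ 0, let f : ℝⁿ → ℝ be differentiable with continuous gradient ∇f, and fix x* ∈ ℝⁿ. For each t ∈ ℕ let d⁽ᵗ⁾ : (ℝⁿ)⁶ → ℝⁿ be differentiable with the operator norm of its total derivative bounded by C at every point. Let (x⁽ᵗ⁾), (y⁽ᵗ⁾), (g⁽ᵗ⁾) be sequences in ℝⁿ satisfying x⁽ᵗ⁺¹⁾ = x⁽ᵗ⁾ − d⁽ᵗ⁾(x⁽ᵗ⁾, ∇f(x⁽ᵗ⁾), x⁽ᵗ⁺¹⁾, g⁽ᵗ⁺¹⁾, y⁽ᵗ⁾, ∇f(y⁽ᵗ⁾)) for all t. If x⁽ᵗ⁾ → x*, y⁽ᵗ⁾ → x*, and g⁽ᵗ⁺¹⁾ → −∇f(x*) as t → ∞, then d⁽ᵗ⁾(x*, ∇f(x*), x*, −∇f(x*),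 x*, ∇f(x*)) → 0 as t → ∞. -/
open Filter Topology

/-- For a family of maps that are Lipschitz with a common constant, the limit of `F t (z t)` along
`z → z₀` is also the limit of `F t z₀`. -/
theorem tendsto_apply_of_norm_sub_le {ι E G : Type*} [SeminormedAddCommGroup E]
    [SeminormedAddCommGroup G] {l : Filter ι} {F : ι → E → G} {C : ℝ}
    (hF : ∀ t u v, ‖F t u - F t v‖ ≤ C * ‖u - v‖) {z : ι → E} {z₀ : E} {a : G}
    (hz : Tendsto z l (𝓝 z₀)) (hFz : Tendsto (fun t => F t (z t)) l (𝓝 a)) :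
    Tendsto (fun t => F t z₀) l (𝓝 a) := by
  have hbound : Tendsto (fun t => C * ‖z₀ - z t‖) l (𝓝 0) := by
    simpa using ((tendsto_const_nhds.sub hz).norm.const_mul C : Tendsto _ l (𝓝 (C * ‖z₀ - z₀‖)))
  have hdiff : Tendsto (fun t => F t z₀ - F t (z t)) l (𝓝 0) :=
    squeeze_zero_norm (fun t => hF t z₀ (z t)) hbound
  simpa using hdiff.add hFz

/-- **Asymptotic fixed-point condition (22) of Theorem 1**: if the iterates generated by
the learned update rule `x⁽ᵗ⁺¹⁾ = x⁽ᵗ⁾ − d⁽ᵗ⁾(x⁽ᵗ⁾, ∇f(x⁽ᵗ⁾), x⁽ᵗ⁺¹⁾, g⁽ᵗ⁺¹⁾, y⁽ᵗ⁾, ∇f(y⁽ᵗ⁾))`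
converge to `x*`, the auxiliary variables converge to `x*`, and the subgradient inputs
converge to `−∇f(x*)`, then the update direction evaluated at the limiting input tuple
tends to zero. Each `d⁽ᵗ⁾` is differentiable on `(ℝⁿ)⁶` (product ℓ² norm) with the
operator norm of its total derivative bounded by `C` everywhere. -/
theorem stmt_5 (n : ℕ) (hn : 0 < n) (C : ℝ) (hC : 0 ≤ C)
    (f : EuclideanSpace ℝ (Fin n) → ℝ) (hf : Differentiable ℝ f)
    (hgrad : Continuous (gradient f))
    (d : ℕ → (PiLp 2 fun _ : Fin 6 => EuclideanSpace ℝ (Fin n)) → EuclideanSpace ℝ (Fin n))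
    (hd : ∀ t, Differentiable ℝ (d t))
    (hdC : ∀ t z, ‖fderiv ℝ (d t) z‖ ≤ C)
    (x y g : ℕ → EuclideanSpace ℝ (Fin n))
    (hx : ∀ t, x (t + 1) = x t -
      d t ((WithLp.equiv 2 _).symm
        ![x t, gradient f (x t), x (t + 1), g (t + 1), y t, gradient f (y t)]))
    (xstar : EuclideanSpace ℝ (Fin n))
    (hxlim : Tendsto x atTop (nhds xstar))
    (hylim : Tendsto y atTop (nhds xstar))
    (hglim : Tendsto (fun t => g (t + 1)) atTop (nhds (-(gradient f xstar)))) :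
    Tendsto (fun t => d t ((WithLp.equiv 2 _).symm
        ![xstar, gradient f xstar, xstar, -(gradient f xstar), xstar, gradient f xstar]))
      atTop (nhds 0) := by
  have hgx : Tendsto (fun t => gradient f (x t)) atTop (𝓝 (gradient f xstar)) :=
    (hgrad.tendsto xstar).comp hxlim
  have hgy : Tendsto (fun t => gradient f (y t)) atTop (𝓝 (gradient f xstar)) :=
    (hgrad.tendsto xstar).comp hylim
  have hxlim' : Tendsto (fun t => x (t + 1)) atTop (𝓝 xstar) :=
    hxlim.comp (tendsto_add_atTop_nat 1)
  refine tendsto_apply_of_norm_sub_le (C := C)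
    (z := fun t => (WithLp.equiv 2 _).symm
      ![x t, gradient f (x t), x (t + 1), g (t + 1), y t, gradient f (y t)])
    (fun t u v => convex_univ.norm_image_sub_le_of_norm_fderiv_le
      (fun w _ => hd t w) (fun w _ => hdC t w) (Set.mem_univ v) (Set.mem_univ u)) ?_ ?_
  · refine ((PiLp.continuous_toLp 2 _).tendsto _).comp (tendsto_pi_nhds.2 fun i => ?_)
    fin_cases i
    exacts [hxlim, hgx, hxlim', hglim, hylim, hgy]
  · have hstep : Tendsto (fun t => x t - x (t + 1)) atTop (𝓝 0) := by
      simpa using hxlim.sub hxlim'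
    refine hstep.congr fun t => ?_
    exact sub_eq_of_eq_add (eq_add_of_sub_eq' (hx t).symm)
end
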